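/- Let λ ∈ (0,3], δ ∈ (0,1], and let r*_δ ∈ ℛ satisfy ℙ(𝒯_{r*_δ}) ≥ 1 − δ. Then there exists a measurable event A with ℙ(A) ≥ 1 − δ such that for every ω ∈ A and every pair i ≠ j with |Θ_{ij}| > (3 + λ)·C·r*_δ, one has |(Θ̂_{r̂(ω)}(ω))_{ij}| > λ·C·r̂(ω), i.e., (i,j) belongs to the estimated edge set Ê(ω) of the thresholded adaptive validation estimator. (Part 2 of the finite-sample graph recovery corollary: every significant entry of the precision matrix is recovered.) -/

import Mathlib

open MeasureTheory Matrix

/-- The ℓ∞-distance on the off-diagonal entries: `max_{i ≠ j} |A_{ij} − B_{ij}|`. -/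
noncomputable def offDist {d : ℕ} (A B : Matrix (Fin d) (Fin d) ℝ) : ℝ :=
  ⨆ p : {p : Fin d × Fin d // p.1 ≠ p.2}, |A p.val.1 p.val.2 - B p.val.1 p.val.2|

theorem entry_le_offDist {d : ℕ} (A B : Matrix (Fin d) (Fin d) ℝ) (i j : Fin d) (h : i ≠ j) :
    |A i j - B i j| ≤ offDist A B :=
  le_ciSup (f := fun p : {p : Fin d × Fin d // p.1 ≠ p.2} =>
    |A p.val.1 p.val.2 - B p.val.1 p.val.2|) (Set.finite_range _).bddAbove ⟨(i, j), h⟩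

/-- Part 2 of the finite-sample graph recovery corollary: with probability at
least `1 − δ`, every significant entry `|Θ_{ij}| > (3 + λ)·C·r*_δ` of the precision
matrix exceeds the threshold, i.e. `|(Θ̂_{r̂(ω)}(ω))_{ij}| > λ·C·r̂(ω)`, so that
`(i,j)` belongs to the estimated edge set of the thresholded AV estimator. -/
theorem stmt_8 {d : ℕ} (hd : 2 ≤ d)
    (Theta : Matrix (Fin d) (Fin d) ℝ)
    (hTheta_symm : Theta.IsSymm) (hTheta_pd : Theta.PosDef)
    (R : Finset ℝ) (hR : R.Nonempty) (hRpos : ∀ r ∈ R, 0 < r)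
    (C : ℝ) (hC : 0 < C)
    {Ω : Type*} [MeasurableSpace Ω]
    (P : Measure Ω) [IsProbabilityMeasure P]
    (ThetaHat : ℝ → Ω → Matrix (Fin d) (Fin d) ℝ)
    (hThat_symm : ∀ r ∈ R, ∀ ω : Ω, (ThetaHat r ω).IsSymm)
    (hThat_pd : ∀ r ∈ R, ∀ ω : Ω, (ThetaHat r ω).PosDef)
    (T : ℝ → Set Ω)
    (hT_meas : ∀ r ∈ R, MeasurableSet (T r))
    (hT_mono : ∀ r' ∈ R, ∀ r'' ∈ R, r' ≤ r'' → T r' ⊆ T r'')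
    (hT_bound : ∀ r ∈ R, ∀ ω ∈ T r, offDist Theta (ThetaHat r ω) ≤ C * r)
    (rhat : Ω → ℝ)
    (hrhat : ∀ ω : Ω, IsLeast
      {r ∈ (↑R : Set ℝ) | ∀ r' ∈ R, ∀ r'' ∈ R, r ≤ r' → r ≤ r'' →
        offDist (ThetaHat r' ω) (ThetaHat r'' ω) ≤ C * (r' + r'')} (rhat ω))
    (lam : ℝ) (hlam : lam ∈ Set.Ioc (0 : ℝ) 3)
    (δ : ℝ) (hδ : δ ∈ Set.Ioc (0 : ℝ) 1)
    (rstar : ℝ) (hrstar : rstar ∈ R)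
    (hP : 1 - ENNReal.ofReal δ ≤ P (T rstar)) :
    ∃ A : Set Ω, MeasurableSet A ∧ 1 - ENNReal.ofReal δ ≤ P A ∧
      ∀ ω ∈ A, ∀ i j : Fin d, i ≠ j →
        (3 + lam) * C * rstar < |Theta i j| →
        lam * C * rhat ω < |ThetaHat (rhat ω) ω i j| := by
  refine ⟨T rstar, hT_meas _ hrstar, hP, ?_⟩
  intro ω hω i j hij hbig
  obtain ⟨⟨hmem, hall⟩, hmin⟩ := hrhat ω
  have hle : rhat ω ≤ rstar := by
    apply hmin
    refine ⟨hrstar, ?_⟩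
    intro r' hr' r'' hr'' h1 h2
    have b1 := hT_bound r' hr' ω (hT_mono _ hrstar _ hr' h1 hω)
    have b2 := hT_bound r'' hr'' ω (hT_mono _ hrstar _ hr'' h2 hω)
    have p1 := hRpos r' hr'
    have p2 := hRpos r'' hr''
    refine Real.iSup_le ?_ (by positivity)
    rintro ⟨⟨a, b⟩, hab⟩
    have e1 := abs_le.1 ((entry_le_offDist Theta (ThetaHat r' ω) a b hab).trans b1)
    have e2 := abs_le.1 ((entry_le_offDist Theta (ThetaHat r'' ω) a b hab).trans b2)
    simp only
    rw [abs_le]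
    constructor <;> linarith [e1.1, e1.2, e2.1, e2.2]
  have e1 := (entry_le_offDist _ _ i j hij).trans (hT_bound rstar hrstar ω hω)
  have e2 := (entry_le_offDist _ _ i j hij).trans (hall rstar hrstar (rhat ω) hmem hle le_rfl)
  have t1 := abs_sub_abs_le_abs_sub (Theta i j) (ThetaHat rstar ω i j)
  have t2 := abs_sub_abs_le_abs_sub (ThetaHat rstar ω i j) (ThetaHat (rhat ω) ω i j)
  have m1 : C * rhat ω ≤ C * rstar := mul_le_mul_of_nonneg_left hle hC.le
  have m2 : lam * (C * rhat ω) ≤ lam * (C * rstar) := mul_le_mul_of_nonneg_left m1 hlam.1.le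
  linarith
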